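/- arXiv:2201.10784 — 4 statements merged into one kernel-verified Lean document; each statement's English description precedes it below -/
import Mathlib

section
/- (Main identity.) For every z ∈ ℂ: s₀(z)³ + s₁(z)³ + s₂(z)³ − 3·s₀(z)·s₁(z)·s₂(z) = 1. -/
open Complex

noncomputable def ζ₁ : ℂ := 1
noncomputable def ζ₂ : ℂ := (-1 + Real.sqrt 3 * Complex.I) / 2
noncomputable def ζ₃ : ℂ := (-1 - Real.sqrt 3 * Complex.I) / 2

/-- `sfun p z = (1/3)·(ζ₁^(−p)·e^{zζ₁} + ζ₂^(−p)·e^{zζ₂} + ζ₃^(−p)·e^{zζ₃})`. -/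
noncomputable def sfun (p : ℕ) (z : ℂ) : ℂ :=
  ((ζ₁ ^ p)⁻¹ * Complex.exp (z * ζ₁) + (ζ₂ ^ p)⁻¹ * Complex.exp (z * ζ₂) +
    (ζ₃ ^ p)⁻¹ * Complex.exp (z * ζ₃)) / 3

theorem ζ₂_add_ζ₃ : ζ₂ + ζ₃ = -1 := by
  unfold ζ₂ ζ₃
  ring

theorem ζ₂_mul_ζ₃ : ζ₂ * ζ₃ = 1 := by
  have h : (Real.sqrt 3 : ℂ) ^ 2 = 3 := by
    rw [← Complex.ofReal_pow, Real.sq_sqrt (by norm_num)]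
    norm_num
  unfold ζ₂ ζ₃
  linear_combination (-(Real.sqrt 3 : ℂ) ^ 2 / 4) * Complex.I_sq + h / 4

theorem ζ₂_sq : ζ₂ ^ 2 = ζ₃ := by
  linear_combination ζ₂ * ζ₂_add_ζ₃ - ζ₂_mul_ζ₃ - ζ₂_add_ζ₃

theorem ζ₃_sq : ζ₃ ^ 2 = ζ₂ := by
  linear_combination ζ₃ * ζ₂_add_ζ₃ - ζ₂_mul_ζ₃ - ζ₂_add_ζ₃

theorem ζ₂_inv : ζ₂⁻¹ = ζ₃ := inv_eq_of_mul_eq_one_right ζ₂_mul_ζ₃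

theorem ζ₃_inv : ζ₃⁻¹ = ζ₂ := inv_eq_of_mul_eq_one_left ζ₂_mul_ζ₃

theorem sum_cubes_sub_eq_mul (x y t : ℂ) :
    x ^ 3 + y ^ 3 + t ^ 3 - 3 * x * y * t =
      (x + y + t) * (x + ζ₂ * y + ζ₃ * t) * (x + ζ₃ * y + ζ₂ * t) := by
  linear_combination
    -(x + y + t) * ((y ^ 2 + t ^ 2 - 2 * y * t) * ζ₂_mul_ζ₃ +
      (x * y + x * t + (ζ₂ + ζ₃ - 1) * y * t) * ζ₂_add_ζ₃)

theorem sfun_zero_add (z : ℂ) : sfun 0 z + sfun 1 z + sfun 2 z = exp z := by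
  simp only [sfun, ζ₁, pow_zero, pow_one, one_pow, inv_one, mul_one, ζ₂_sq, ζ₃_sq, ζ₂_inv, ζ₃_inv]
  linear_combination (exp (z * ζ₂) + exp (z * ζ₃)) / 3 * ζ₂_add_ζ₃

theorem sfun_zero_add_ζ₂_mul (z : ℂ) :
    sfun 0 z + ζ₂ * sfun 1 z + ζ₃ * sfun 2 z = exp (z * ζ₂) := by
  simp only [sfun, ζ₁, pow_zero, pow_one, one_pow, inv_one, mul_one, ζ₂_sq, ζ₃_sq, ζ₂_inv, ζ₃_inv]
  linear_combination (exp z + exp (z * ζ₃)) / 3 * ζ₂_add_ζ₃ +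
    2 * exp (z * ζ₂) / 3 * ζ₂_mul_ζ₃ + exp (z * ζ₃) / 3 * (ζ₂_sq + ζ₃_sq)

theorem sfun_zero_add_ζ₃_mul (z : ℂ) :
    sfun 0 z + ζ₃ * sfun 1 z + ζ₂ * sfun 2 z = exp (z * ζ₃) := by
  simp only [sfun, ζ₁, pow_zero, pow_one, one_pow, inv_one, mul_one, ζ₂_sq, ζ₃_sq, ζ₂_inv, ζ₃_inv]
  linear_combination (exp z + exp (z * ζ₂)) / 3 * ζ₂_add_ζ₃ +
    2 * exp (z * ζ₃) / 3 * ζ₂_mul_ζ₃ + exp (z * ζ₂) / 3 * (ζ₂_sq + ζ₃_sq)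

theorem stmt3 (z : ℂ) :
    sfun 0 z ^ 3 + sfun 1 z ^ 3 + sfun 2 z ^ 3 - 3 * sfun 0 z * sfun 1 z * sfun 2 z = 1 := by
  rw [sum_cubes_sub_eq_mul, sfun_zero_add, sfun_zero_add_ζ₂_mul, sfun_zero_add_ζ₃_mul,
    ← Complex.exp_add, ← Complex.exp_add, Complex.exp_eq_one_iff]
  exact ⟨0, by linear_combination z * ζ₂_add_ζ₃⟩
end

section
/- (Location of the zeros of s₀, s₁, s₂.) For each p ∈ {0,1,2}, every z ∈ ℂ with s_p(z) = 0 has the form z = −x·ζ₂^l for some real x ≥ 0 and some l ∈ {0,1,2}. Moreover, for real x > 0: s₀(−x) = 0 if and only if cos(√3·x/2) = −(1/2)·e^{−3x/2}; s₁(−x) = 0 if and only if cos(√3·x/2 − π/3) = (1/2)·e^{−3x/2}; s₂(−x) = 0 if and only if cos(√3·x/2 + π/3) = (1/2)·e^{−3x/2}; and s₁(0) = s₂(0) = 0 while s₀(0) = 1. -/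
open Complex

theorem ζ₂_eq_exp : ζ₂ = Complex.exp ((2 * Real.pi / 3 : ℝ) * I) := by
  have h : 2 * Real.pi / 3 = Real.pi - Real.pi / 3 := by ring
  rw [Complex.exp_mul_I, ← Complex.ofReal_cos, ← Complex.ofReal_sin, h, Real.cos_pi_sub,
    Real.sin_pi_sub, Real.cos_pi_div_three, Real.sin_pi_div_three, ζ₂]
  push_cast
  ring

theorem ζ₃_eq_exp : ζ₃ = Complex.exp (-((2 * Real.pi / 3 : ℝ) * I)) := by
  have h : 2 * Real.pi / 3 = Real.pi - Real.pi / 3 := by ring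
  rw [← neg_mul, Complex.exp_mul_I, Complex.cos_neg, Complex.sin_neg, ← Complex.ofReal_cos,
    ← Complex.ofReal_sin, h, Real.cos_pi_sub,
    Real.sin_pi_sub, Real.cos_pi_div_three, Real.sin_pi_div_three, ζ₃]
  push_cast
  ring

theorem ofReal_sqrt_three_sq : ((Real.sqrt 3 : ℝ) : ℂ) ^ 2 = 3 := by
  rw [← Complex.ofReal_pow, Real.sq_sqrt (by norm_num)]
  norm_num

theorem one_add_ζ₂_add_ζ₃ : 1 + ζ₂ + ζ₃ = 0 := by
  rw [ζ₂, ζ₃]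
  ring

theorem ζ₂_ne_zero : ζ₂ ≠ 0 := left_ne_zero_of_mul_eq_one ζ₂_mul_ζ₃

theorem sfun_neg (p : ℕ) (y : ℂ) :
    sfun p (-y) = Complex.exp (y / 2) / 3 * (Complex.exp (-(3 * y / 2)) +
      2 * Complex.cos (Real.sqrt 3 * y / 2 + p * (2 * Real.pi / 3 : ℝ))) := by
  have h1 : -y * 1 = y / 2 + -(3 * y / 2) := by ring
  have h2 : -(p * ((2 * Real.pi / 3 : ℝ) * I)) + -y * ζ₂ =
      y / 2 + -(Real.sqrt 3 * y / 2 + p * (2 * Real.pi / 3 : ℝ)) * I := by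
    rw [ζ₂]
    ring
  have h3 : -(p * -((2 * Real.pi / 3 : ℝ) * I)) + -y * ζ₃ =
      y / 2 + (Real.sqrt 3 * y / 2 + p * (2 * Real.pi / 3 : ℝ)) * I := by
    rw [ζ₃]
    ring
  have e2 : (ζ₂ ^ p)⁻¹ * Complex.exp (-y * ζ₂) = Complex.exp (y / 2) *
      Complex.exp (-(Real.sqrt 3 * y / 2 + p * (2 * Real.pi / 3 : ℝ)) * I) := by
    rw [← Complex.exp_add, ← h2, Complex.exp_add, Complex.exp_neg, Complex.exp_nat_mul,
      ← ζ₂_eq_exp]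
  have e3 : (ζ₃ ^ p)⁻¹ * Complex.exp (-y * ζ₃) = Complex.exp (y / 2) *
      Complex.exp ((Real.sqrt 3 * y / 2 + p * (2 * Real.pi / 3 : ℝ)) * I) := by
    rw [← Complex.exp_add, ← h3, Complex.exp_add, Complex.exp_neg (p * _), Complex.exp_nat_mul,
      ← ζ₃_eq_exp]
  rw [sfun, e2, e3, ζ₁, one_pow, inv_one, one_mul, h1, Complex.exp_add, Complex.two_cos]
  ring

theorem sfun_neg_eq_zero_iff (p : ℕ) (y : ℂ) :
    sfun p (-y) = 0 ↔ Complex.exp (-(3 * y / 2)) +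
      2 * Complex.cos (Real.sqrt 3 * y / 2 + p * (2 * Real.pi / 3 : ℝ)) = 0 := by
  rw [sfun_neg, mul_eq_zero, or_iff_right]
  exact div_ne_zero (Complex.exp_ne_zero _) three_ne_zero

theorem sfun_neg_ofReal_eq_zero_iff (p : ℕ) (x : ℝ) :
    sfun p (-(x : ℂ)) = 0 ↔ Real.exp (-(3 * x / 2)) +
      2 * Real.cos (Real.sqrt 3 * x / 2 + p * (2 * Real.pi / 3)) = 0 := by
  rw [sfun_neg_eq_zero_iff]
  norm_cast

theorem sfun_mul_ζ₂ (p : ℕ) (z : ℂ) : sfun p (z * ζ₂) = ζ₂ ^ p * sfun p z := by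
  have h1 : z * ζ₂ * ζ₂ = z * ζ₃ := by rw [← ζ₂_sq]; ring
  have h2 : z * ζ₂ * ζ₃ = z := by rw [mul_assoc, ζ₂_mul_ζ₃, mul_one]
  have h3 : (ζ₃ ^ p)⁻¹ = ζ₂ ^ p := by
    rw [← inv_pow, inv_eq_of_mul_eq_one_left ζ₂_mul_ζ₃]
  have h4 : ζ₂ ^ p * ζ₂ ^ p = (ζ₂ ^ p)⁻¹ := by
    rw [← mul_pow, ← sq, ζ₂_sq, ← inv_pow, inv_eq_of_mul_eq_one_right ζ₂_mul_ζ₃]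
  have h5 : ζ₂ ^ p * (ζ₂ ^ p)⁻¹ = 1 := mul_inv_cancel₀ (pow_ne_zero _ ζ₂_ne_zero)
  simp only [sfun, h1, h2, h3, ζ₁, one_pow, inv_one, one_mul, mul_one]
  linear_combination -(Complex.exp (z * ζ₂) / 3) * h5 - (Complex.exp (z * ζ₃) / 3) * h4

/-- Every zero `y = u + v * I` of `exp (-3y/2) + 2 cos (√3 y/2 + θ)` with `0 ≤ u` is real. -/
theorem im_eq_zero_of_exp_add_cos_eq_zero {u v θ : ℝ} (hu : 0 ≤ u)
    (h : Complex.exp (-(3 * (u + v * I) / 2)) +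
      2 * Complex.cos (Real.sqrt 3 * (u + v * I) / 2 + θ) = 0) : v = 0 := by
  set a := Real.sqrt 3 * u / 2 + θ with ha
  set b := Real.sqrt 3 * v / 2 with hb
  have s3 : Real.sqrt 3 ^ 2 = 3 := Real.sq_sqrt (by norm_num)
  have h1 : -(3 * (u + v * I) / 2) =
      ((-(3 * u / 2) : ℝ) : ℂ) + ((-(Real.sqrt 3 * b) : ℝ) : ℂ) * I := by
    have : Real.sqrt 3 * b = 3 * v / 2 := by rw [hb]; linear_combination v / 2 * s3
    rw [this]
    push_cast
    ring
  have h2 : Real.sqrt 3 * (u + v * I) / 2 + θ = (a : ℂ) + (b : ℂ) * I := by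
    rw [ha, hb]
    push_cast
    ring
  rw [h1, h2, Complex.exp_add, Complex.exp_mul_I, Complex.cos_add_mul_I] at h
  have h3 : ((Real.exp (-(3 * u / 2)) * Real.cos (Real.sqrt 3 * b) +
      2 * Real.cos a * Real.cosh b : ℝ) : ℂ) +
      ((-(Real.exp (-(3 * u / 2)) * Real.sin (Real.sqrt 3 * b)) -
      2 * Real.sin a * Real.sinh b : ℝ) : ℂ) * I = 0 := by
    push_cast [Complex.cos_neg, Complex.sin_neg] at h ⊢
    linear_combination h
  have hre := congrArg Complex.re h3
  have him := congrArg Complex.im h3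
  simp only [add_re, add_im, mul_re, mul_im, ofReal_re, ofReal_im, I_re, I_im, mul_zero, mul_one,
    sub_zero, add_zero, zero_add, zero_re, zero_im] at hre him
  by_contra hv
  have hb0 : b ≠ 0 := by rw [hb]; positivity
  have hE0 := Real.exp_pos (-(3 * u / 2))
  have hE1 : Real.exp (-(3 * u / 2)) ≤ 1 := Real.exp_le_one_iff.2 (by linarith)
  set E := Real.exp (-(3 * u / 2))
  have hE2 : E ^ 2 ≤ 1 := pow_le_one₀ hE0.le hE1
  have hcosh : 1 < Real.cosh b ^ 2 := by
    nlinarith [Real.one_lt_cosh.2 hb0]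
  have hsinh0 : 0 < Real.sinh b ^ 2 := by
    have := Real.cosh_sq b
    linarith
  have hb_le : b ^ 2 ≤ Real.sinh b ^ 2 := by
    rw [sq_le_sq, Real.abs_sinh]
    exact Real.self_le_sinh_iff.2 (abs_nonneg b)
  have hsin : Real.sin (Real.sqrt 3 * b) ^ 2 ≤ 3 * Real.sinh b ^ 2 := by
    have : Real.sin (Real.sqrt 3 * b) ^ 2 ≤ (Real.sqrt 3 * b) ^ 2 := sq_le_sq.2 Real.abs_sin_le_abs
    rw [mul_pow, s3] at this
    linarith
  have hcos := Real.cos_sq_le_one (Real.sqrt 3 * b)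
  have hc : 4 * Real.cos a ^ 2 * Real.cosh b ^ 2 = E ^ 2 * Real.cos (Real.sqrt 3 * b) ^ 2 := by
    linear_combination (2 * Real.cos a * Real.cosh b - E * Real.cos (Real.sqrt 3 * b)) * hre
  have hs : 4 * Real.sin a ^ 2 * Real.sinh b ^ 2 = E ^ 2 * Real.sin (Real.sqrt 3 * b) ^ 2 := by
    linear_combination (-2 * Real.sin a * Real.sinh b + E * Real.sin (Real.sqrt 3 * b)) * him
  have hs' : 4 * Real.sin a ^ 2 ≤ 3 := by
    refine le_of_mul_le_mul_right ?_ hsinh0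
    rw [hs]
    nlinarith [sq_nonneg (Real.sin (Real.sqrt 3 * b))]
  have hc' : 4 * Real.cos a ^ 2 * Real.cosh b ^ 2 ≤ 1 := by
    rw [hc]
    nlinarith [sq_nonneg (Real.cos (Real.sqrt 3 * b))]
  nlinarith [Real.sin_sq_add_cos_sq a]

theorem exists_eq_neg_of_sfun_eq_zero {p : ℕ} {z : ℂ} (hz : z.re ≤ 0) (h : sfun p z = 0) :
    ∃ x : ℝ, 0 ≤ x ∧ z = -(x : ℂ) := by
  have hz' : z = -(((-z.re : ℝ) : ℂ) + ((-z.im : ℝ) : ℂ) * I) := by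
    apply Complex.ext <;> simp
  rw [hz', sfun_neg_eq_zero_iff] at h
  have him : -z.im = 0 := im_eq_zero_of_exp_add_cos_eq_zero (u := -z.re) (θ := p * (2 * Real.pi / 3))
    (by linarith) (by push_cast at h ⊢; exact h)
  refine ⟨-z.re, by linarith, ?_⟩
  conv_lhs => rw [hz', him]
  simp

theorem exists_eq_neg_mul_ζ₂_pow_of_sfun_eq_zero {p : ℕ} {z : ℂ} (h : sfun p z = 0) :
    ∃ (x : ℝ) (l : Fin 3), 0 ≤ x ∧ z = -(x : ℂ) * ζ₂ ^ (l : ℕ) := by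
  have h₂ : sfun p (z * ζ₂) = 0 := by rw [sfun_mul_ζ₂, h, mul_zero]
  have h₃ : sfun p (z * ζ₂ * ζ₂) = 0 := by rw [sfun_mul_ζ₂, h₂, mul_zero]
  have hsum : z + z * ζ₂ + z * ζ₂ * ζ₂ = 0 := by
    linear_combination z * one_add_ζ₂_add_ζ₃ + z * ζ₂_sq
  have hre := congrArg Complex.re hsum
  simp only [Complex.add_re, Complex.zero_re] at hre
  rcases le_or_gt z.re 0 with h1 | h1
  · obtain ⟨x, hx, hzx⟩ := exists_eq_neg_of_sfun_eq_zero h1 h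
    exact ⟨x, 0, hx, by simpa using hzx⟩
  rcases le_or_gt (z * ζ₂).re 0 with h2 | h2
  · obtain ⟨x, hx, hzx⟩ := exists_eq_neg_of_sfun_eq_zero h2 h₂
    refine ⟨x, 2, hx, ?_⟩
    rw [← hzx, Fin.val_two, ζ₂_sq, mul_assoc, ζ₂_mul_ζ₃, mul_one]
  · obtain ⟨x, hx, hzx⟩ := exists_eq_neg_of_sfun_eq_zero (by linarith) h₃
    refine ⟨x, 1, hx, ?_⟩
    rw [← hzx, Fin.val_one, pow_one]
    linear_combination -z * ζ₂_mul_ζ₃ - z * ζ₂ * ζ₂_sq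

theorem stmt10 :
    (∀ p : Fin 3, ∀ z : ℂ, sfun (p : ℕ) z = 0 →
      ∃ (x : ℝ) (l : Fin 3), 0 ≤ x ∧ z = -(x : ℂ) * ζ₂ ^ (l : ℕ)) ∧
    (∀ x : ℝ, 0 < x →
      ((sfun 0 (-(x : ℂ)) = 0 ↔
          Real.cos (Real.sqrt 3 * x / 2) = -(1 / 2) * Real.exp (-(3 * x / 2))) ∧
        (sfun 1 (-(x : ℂ)) = 0 ↔
          Real.cos (Real.sqrt 3 * x / 2 - Real.pi / 3) = (1 / 2) * Real.exp (-(3 * x / 2))) ∧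
        (sfun 2 (-(x : ℂ)) = 0 ↔
          Real.cos (Real.sqrt 3 * x / 2 + Real.pi / 3) = (1 / 2) * Real.exp (-(3 * x / 2))))) ∧
    sfun 1 0 = 0 ∧ sfun 2 0 = 0 ∧ sfun 0 0 = 1 := by
  refine ⟨fun p z h => exists_eq_neg_mul_ζ₂_pow_of_sfun_eq_zero h, fun x _ => ⟨?_, ?_, ?_⟩,
    ?_, ?_, ?_⟩
  · rw [sfun_neg_ofReal_eq_zero_iff, Nat.cast_zero, zero_mul, add_zero]
    constructor <;> intro h <;> linarith
  · have h : Real.sqrt 3 * x / 2 + (1 : ℕ) * (2 * Real.pi / 3) =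
        Real.sqrt 3 * x / 2 - Real.pi / 3 + Real.pi := by
      push_cast
      ring
    rw [sfun_neg_ofReal_eq_zero_iff, h, Real.cos_add_pi]
    constructor <;> intro h <;> linarith
  · have h : Real.sqrt 3 * x / 2 + (2 : ℕ) * (2 * Real.pi / 3) =
        Real.sqrt 3 * x / 2 + Real.pi / 3 + Real.pi := by
      push_cast
      ring
    rw [sfun_neg_ofReal_eq_zero_iff, h, Real.cos_add_pi]
    constructor <;> intro h <;> linarith
  · have h₂ : ζ₂⁻¹ = ζ₃ := inv_eq_of_mul_eq_one_right ζ₂_mul_ζ₃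
    have h₃ : ζ₃⁻¹ = ζ₂ := inv_eq_of_mul_eq_one_left ζ₂_mul_ζ₃
    simp only [sfun, ζ₁, pow_one, inv_one, h₂, h₃, zero_mul, Complex.exp_zero]
    linear_combination one_add_ζ₂_add_ζ₃ / 3
  · have h₂ : ζ₂⁻¹ = ζ₃ := inv_eq_of_mul_eq_one_right ζ₂_mul_ζ₃
    have h₃ : ζ₃⁻¹ = ζ₂ := inv_eq_of_mul_eq_one_left ζ₂_mul_ζ₃
    have h₄ : ζ₃ ^ 2 = ζ₂ := by
      rw [sq]
      nth_rewrite 1 [← ζ₂_sq]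
      linear_combination ζ₂ * ζ₂_mul_ζ₃
    simp only [sfun, ζ₁, one_pow, inv_one, ζ₂_sq, h₄, h₂, h₃, zero_mul, Complex.exp_zero]
    linear_combination one_add_ζ₂_add_ζ₃ / 3
  · norm_num [sfun]
end

section
/- (The weighted class is closed under autocorrelation.) Let a > 0 and let q : (0,∞) → ℂ be measurable with ∫₀^∞ e^{2ax}·|q(x)|² dx < ∞. Then for every s ≥ 0 the integral g_q(s) = ∫₀^∞ q(x+s)·conj(q(x)) dx converges absolutely, and ∫₀^∞ e^{2as}·|g_q(s)|² ds < ∞. -/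
open Complex

open MeasureTheory Set

/-- q̃ for direction ζ: `∫₀^∞ e^{−iλζx} q(x) dx`. -/
noncomputable def qt (q : ℝ → ℂ) (ζ lam : ℂ) : ℂ :=
  ∫ x in Ioi (0:ℝ), Complex.exp (-Complex.I * lam * ζ * x) * q x

/-- Autocorrelation `g_q(s) = ∫₀^∞ q(x+s) conj(q(x)) dx`. -/
noncomputable def gq (q : ℝ → ℂ) (s : ℝ) : ℂ :=
  ∫ x in Ioi (0:ℝ), q (x + s) * (starRingEnd ℂ) (q x)

/-- `m_k(λ) = ∫₀^∞ e^{−iλζ_k s} g_q(s) ds`. -/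
noncomputable def mker (q : ℝ → ℂ) (ζ lam : ℂ) : ℂ :=
  ∫ s in Ioi (0:ℝ), Complex.exp (-Complex.I * lam * ζ * s) * gq q s

/-- `f*(λ) = conj (f (conj λ))`. -/
noncomputable def starF (f : ℂ → ℂ) (lam : ℂ) : ℂ :=
  (starRingEnd ℂ) (f ((starRingEnd ℂ) lam))

/-- `m_{s₀}(λ) = (m₁(λ)+m₂(λ)+m₃(λ))/3`. -/
noncomputable def ms0 (q : ℝ → ℂ) (lam : ℂ) : ℂ :=
  (mker q ζ₁ lam + mker q ζ₂ lam + mker q ζ₃ lam) / 3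

/-- `m_{s₂}(λ) = (ζ₁m₁(λ)+ζ₂m₂(λ)+ζ₃m₃(λ))/(3(iλ)²)`. -/
noncomputable def ms2 (q : ℝ → ℂ) (lam : ℂ) : ℂ :=
  (ζ₁ * mker q ζ₁ lam + ζ₂ * mker q ζ₂ lam + ζ₃ * mker q ζ₃ lam) /
    (3 * (Complex.I * lam) ^ 2)

/-- `b(λ) = 1 + iα m_{s₂}(λ)`. -/
noncomputable def bcoef (α : ℝ) (q : ℝ → ℂ) (lam : ℂ) : ℂ :=
  1 + Complex.I * α * ms2 q lam

/-- Generic Jost solution with oscillation direction `ζk` and coefficient direction `ζc`. -/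
noncomputable def jost (α : ℝ) (q : ℝ → ℂ) (ζk ζc : ℂ) (lam : ℂ) (x : ℝ) : ℂ :=
  bcoef α q lam * Complex.exp (Complex.I * lam * ζk * x) -
    Complex.I * α * starF (qt q ζc) lam *
      ∫ t in Ioi x, sfun 2 (Complex.I * lam * ((x : ℂ) - (t : ℂ))) / (Complex.I * lam) ^ 2 * q t

/-- `ψ₁(λ,x)`. -/
noncomputable def psi1 (α : ℝ) (q : ℝ → ℂ) (lam : ℂ) (x : ℝ) : ℂ := jost α q ζ₁ ζ₁ lam x

/-- `ψ₂(λ,x)`. -/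
noncomputable def psi2 (α : ℝ) (q : ℝ → ℂ) (lam : ℂ) (x : ℝ) : ℂ := jost α q ζ₂ ζ₃ lam x

/-- `ψ₃(λ,x)`. -/
noncomputable def psi3 (α : ℝ) (q : ℝ → ℂ) (lam : ℂ) (x : ℝ) : ℂ := jost α q ζ₃ ζ₂ lam x

open scoped ENNReal

/-- The square of an integral of a product is at most the product of the integrals of squares. -/
theorem lintegral_mul_sq_le {α : Type*} [MeasurableSpace α] (μ : Measure α) {f g : α → ℝ≥0∞}
    (hf : AEMeasurable f μ) (hg : AEMeasurable g μ) :
    (∫⁻ x, f x * g x ∂μ) ^ 2 ≤ (∫⁻ x, f x ^ 2 ∂μ) * ∫⁻ x, g x ^ 2 ∂μ := by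
  have h := ENNReal.lintegral_mul_le_Lp_mul_Lq μ Real.HolderConjugate.two_two hf hg
  simp only [Pi.mul_apply, ENNReal.rpow_two] at h
  calc (∫⁻ x, f x * g x ∂μ) ^ 2
      ≤ ((∫⁻ x, f x ^ 2 ∂μ) ^ (1 / 2 : ℝ) * (∫⁻ x, g x ^ 2 ∂μ) ^ (1 / 2 : ℝ)) ^ 2 := by gcongr
    _ = _ := by
      rw [mul_pow, ← ENNReal.rpow_two, ← ENNReal.rpow_two, ← ENNReal.rpow_mul,
        ← ENNReal.rpow_mul]
      norm_num

theorem setLIntegral_Ioi_add_right_le (F : ℝ → ℝ≥0∞) {t : ℝ} (ht : 0 ≤ t) :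
    ∫⁻ x in Ioi (0 : ℝ), F (x + t) ≤ ∫⁻ x in Ioi (0 : ℝ), F x := by
  rw [← lintegral_indicator measurableSet_Ioi, ← lintegral_indicator measurableSet_Ioi,
    ← lintegral_add_right_eq_self (fun x => (Ioi (0 : ℝ)).indicator F x) t]
  refine lintegral_mono fun x => ?_
  by_cases hx : 0 < x
  · have hxt : 0 < x + t := by linarith
    simp [indicator, hx, hxt]
  · simp [indicator, hx]

theorem setLIntegral_setLIntegral_add_mul_lt_top {F G : ℝ → ℝ≥0∞} (hFm : Measurable F)
    (hGm : Measurable G) (hF : ∫⁻ x in Ioi (0 : ℝ), F x < ∞)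
    (hG : ∫⁻ x in Ioi (0 : ℝ), G x < ∞) :
    ∫⁻ s in Ioi (0 : ℝ), ∫⁻ x in Ioi (0 : ℝ), F (x + s) * G x < ∞ := by
  rw [lintegral_lintegral_swap (by fun_prop)]
  calc ∫⁻ x in Ioi (0 : ℝ), ∫⁻ s in Ioi (0 : ℝ), F (x + s) * G x
      ≤ ∫⁻ x in Ioi (0 : ℝ), (∫⁻ s in Ioi (0 : ℝ), F s) * G x := by
        refine setLIntegral_mono (by fun_prop) fun x hx => ?_
        rw [lintegral_mul_const _ (by fun_prop)]
        gcongr ?_ * _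
        simpa only [add_comm x] using setLIntegral_Ioi_add_right_le F (le_of_lt hx)
    _ = (∫⁻ s in Ioi (0 : ℝ), F s) * ∫⁻ x in Ioi (0 : ℝ), G x := lintegral_const_mul _ hGm
    _ < ∞ := ENNReal.mul_lt_top hF hG

theorem exp_mul_enorm_gq_sq_le (a : ℝ) (q : ℝ → ℂ) (hq : Measurable q) (s : ℝ) :
    ENNReal.ofReal (Real.exp (2 * a * s)) * ‖gq q s‖ₑ ^ 2 ≤
      (∫⁻ x in Ioi (0 : ℝ), ENNReal.ofReal (Real.exp (-(2 * a) * x))) *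
        ∫⁻ x in Ioi (0 : ℝ),
          ENNReal.ofReal (Real.exp (2 * a * (x + s))) * ‖q (x + s)‖ₑ ^ 2 * ‖q x‖ₑ ^ 2 := by
  have hexp : ∀ u : ℝ, ENNReal.ofReal (Real.exp (2 * u)) = ENNReal.ofReal (Real.exp u) ^ 2 :=
    fun u => by rw [← ENNReal.ofReal_pow (Real.exp_nonneg u), ← Real.exp_nat_mul]; simp
  have hle : ENNReal.ofReal (Real.exp (a * s)) * ‖gq q s‖ₑ ≤
      ∫⁻ x in Ioi (0 : ℝ), ENNReal.ofReal (Real.exp (-a * x)) *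
        (ENNReal.ofReal (Real.exp (a * (x + s))) * ‖q (x + s)‖ₑ * ‖q x‖ₑ) := by
    calc ENNReal.ofReal (Real.exp (a * s)) * ‖gq q s‖ₑ
        ≤ ENNReal.ofReal (Real.exp (a * s)) *
          ∫⁻ x in Ioi (0 : ℝ), ‖q (x + s) * (starRingEnd ℂ) (q x)‖ₑ := by
          gcongr
          exact enorm_integral_le_lintegral_enorm _
      _ = _ := by
          rw [← lintegral_const_mul' _ _ ENNReal.ofReal_ne_top]
          congr 1 with x
          have h : Real.exp (a * s) = Real.exp (-a * x) * Real.exp (a * (x + s)) := by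
            rw [← Real.exp_add]; ring_nf
          rw [h, ENNReal.ofReal_mul (Real.exp_nonneg _), enorm_mul, RCLike.enorm_conj]
          ring
  calc ENNReal.ofReal (Real.exp (2 * a * s)) * ‖gq q s‖ₑ ^ 2
      = (ENNReal.ofReal (Real.exp (a * s)) * ‖gq q s‖ₑ) ^ 2 := by
        rw [mul_assoc 2 a s, hexp, mul_pow]
    _ ≤ _ := pow_le_pow_left' hle 2
    _ ≤ _ := lintegral_mul_sq_le _ (by fun_prop) (by fun_prop)
    _ = _ := by
        simp only [mul_pow, ← hexp]
        simp only [mul_assoc, neg_mul, mul_neg]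

theorem stmt11 (a : ℝ) (ha : 0 < a) (q : ℝ → ℂ) (hq : Measurable q)
    (hint : IntegrableOn (fun x => Real.exp (2 * a * x) * ‖q x‖ ^ 2) (Ioi 0)) :
    (∀ s : ℝ, 0 ≤ s → IntegrableOn (fun x => q (x + s) * (starRingEnd ℂ) (q x)) (Ioi 0)) ∧
    IntegrableOn (fun s => Real.exp (2 * a * s) * ‖gq q s‖ ^ 2) (Ioi 0) := by
  have hmain : ∫⁻ x in Ioi (0 : ℝ), ENNReal.ofReal (Real.exp (2 * a * x)) * ‖q x‖ₑ ^ 2 < ∞ := by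
    have h := hint.2
    simpa only [HasFiniteIntegral, enorm_mul, enorm_pow, enorm_norm,
      Real.enorm_of_nonneg (Real.exp_nonneg _)] using h
  have hle : ∀ x : ℝ, 0 ≤ x →
      ‖q x‖ₑ ^ 2 ≤ ENNReal.ofReal (Real.exp (2 * a * x)) * ‖q x‖ₑ ^ 2 := fun x hx =>
    le_mul_of_one_le_left' (ENNReal.one_le_ofReal.2 (Real.one_le_exp (by positivity)))
  have hsq : ∫⁻ x in Ioi (0 : ℝ), ‖q x‖ₑ ^ 2 < ∞ :=
    (setLIntegral_mono (by fun_prop) fun x hx => hle x (le_of_lt hx)).trans_lt hmain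
  refine ⟨fun s hs => ⟨Measurable.aestronglyMeasurable (by fun_prop), ?_⟩, ⟨?_, ?_⟩⟩
  · simp only [HasFiniteIntegral, enorm_mul, RCLike.enorm_conj]
    have h := (lintegral_mul_sq_le (volume.restrict (Ioi (0 : ℝ)))
      (f := fun x => ‖q (x + s)‖ₑ) (g := fun x => ‖q x‖ₑ) (by fun_prop) (by fun_prop)).trans_lt
      (ENNReal.mul_lt_top
        ((setLIntegral_Ioi_add_right_le (fun x => ‖q x‖ₑ ^ 2) hs).trans_lt hsq) hsq)
    simpa using h
  · have hg : StronglyMeasurable (gq q) :=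
      StronglyMeasurable.integral_prod_right
        (f := fun s x => q (x + s) * (starRingEnd ℂ) (q x))
        (Measurable.stronglyMeasurable (by fun_prop))
    have hgm : Measurable (gq q) := hg.measurable
    fun_prop
  · simp only [HasFiniteIntegral, enorm_mul, enorm_pow, enorm_norm,
      Real.enorm_of_nonneg (Real.exp_nonneg _)]
    have hC : ∫⁻ x in Ioi (0 : ℝ), ENNReal.ofReal (Real.exp (-(2 * a) * x)) < ∞ := by
      have h := (exp_neg_integrableOn_Ioi 0 (b := 2 * a) (by positivity)).2
      simpa only [HasFiniteIntegral, Real.enorm_of_nonneg (Real.exp_nonneg _)] using h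
    refine (lintegral_mono fun s => exp_mul_enorm_gq_sq_le a q hq s).trans_lt ?_
    rw [lintegral_const_mul' _ _ hC.ne]
    exact ENNReal.mul_lt_top hC (setLIntegral_setLIntegral_add_mul_lt_top
      (F := fun x => ENNReal.ofReal (Real.exp (2 * a * x)) * ‖q x‖ₑ ^ 2)
      (G := fun x => ‖q x‖ₑ ^ 2) (by fun_prop) (by fun_prop) hmain hsq)
end

section
/- (Normalization of the Jost solutions.) For every λ ∈ ℂ with 0 < |λ| < a/3, the Jost solutions satisfy ∫₀^∞ ψ₁(λ,x)·conj(q(x)) dx = q̃₁*(λ), ∫₀^∞ ψ₂(λ,x)·conj(q(x)) dx = q̃₃*(λ), and ∫₀^∞ ψ₃(λ,x)·conj(q(x)) dx = q̃₂*(λ). -/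
open Complex

open MeasureTheory Set

lemma norm_ζ₁ : ‖ζ₁‖ = 1 := by simp [ζ₁]

lemma norm_ζ₂ : ‖ζ₂‖ = 1 := by
  have h : (Real.sqrt 3) ^ 2 = 3 := Real.sq_sqrt (by norm_num)
  have : normSq ζ₂ = 1 := by
    simp [ζ₂, normSq_apply]
    nlinarith
  rw [norm_def, this, Real.sqrt_one]

lemma conj_ζ₁ : (starRingEnd ℂ) ζ₁ = ζ₁ := by simp [ζ₁]

lemma conj_ζ₂ : (starRingEnd ℂ) ζ₂ = ζ₃ := by
  simp [ζ₂, ζ₃, map_div₀, sub_eq_add_neg, conj_ofReal, Complex.conj_ofNat]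

lemma conj_ζ₃ : (starRingEnd ℂ) ζ₃ = ζ₂ := by rw [← conj_ζ₂, conj_conj]

lemma norm_ζ₃ : ‖ζ₃‖ = 1 := by rw [← conj_ζ₂, norm_conj, norm_ζ₂]

lemma inv_sq_eq_of_cube {z : ℂ} (h : z ^ 3 = 1) : (z ^ 2)⁻¹ = z :=
  inv_eq_of_mul_eq_one_left (by rw [← h]; ring)

lemma ζ₂_cube : ζ₂ ^ 3 = 1 := by
  have h : ((Real.sqrt 3 : ℝ) : ℂ) ^ 2 = 3 := by
    rw [← ofReal_pow, Real.sq_sqrt (by norm_num)]; simp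
  have hI := I_sq
  unfold ζ₂
  grind

lemma ζ₃_cube : ζ₃ ^ 3 = 1 := by rw [← conj_ζ₂, ← map_pow, ζ₂_cube, map_one]

lemma sfun_two (z : ℂ) :
    sfun 2 z = (ζ₁ * exp (z * ζ₁) + ζ₂ * exp (z * ζ₂) + ζ₃ * exp (z * ζ₃)) / 3 := by
  rw [sfun, inv_sq_eq_of_cube ζ₂_cube, inv_sq_eq_of_cube ζ₃_cube,
    inv_sq_eq_of_cube (z := ζ₁) (by simp [ζ₁])]

/-- `starF (qt q ζ)` is the integral with the conjugate direction. -/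
lemma starF_qt (q : ℝ → ℂ) (ζ lam : ℂ) :
    starF (qt q ζ) lam =
      ∫ x in Ioi (0:ℝ), exp (I * lam * (starRingEnd ℂ) ζ * x) * (starRingEnd ℂ) (q x) := by
  rw [starF, qt, ← integral_conj]
  simp [← exp_conj, conj_ofReal]

lemma norm_exp_mul_le {w : ℂ} {c x : ℝ} (hw : ‖w‖ ≤ c) (hx : 0 ≤ x) :
    ‖exp (w * x)‖ ≤ Real.exp (c * x) := by
  rw [norm_exp, Real.exp_le_exp, re_mul_ofReal]
  exact mul_le_mul_of_nonneg_right ((re_le_norm w).trans hw) hx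

/-- A weighted `L²` bound gives an exponentially weighted `L¹` bound at any smaller rate. -/
lemma integrableOn_exp_mul_norm {a c : ℝ} (hc : c < a) {q : ℝ → ℂ} (hq : Measurable q)
    (hint : IntegrableOn (fun x => Real.exp (2 * a * x) * ‖q x‖ ^ 2) (Ioi 0)) :
    IntegrableOn (fun x => Real.exp (c * x) * ‖q x‖) (Ioi 0) := by
  have hexp : IntegrableOn (fun x : ℝ => Real.exp ((2 * (c - a)) * x)) (Ioi 0) :=
    integrableOn_exp_mul_Ioi (by linarith) 0
  refine (hexp.add hint).mono' (by fun_prop) (Filter.Eventually.of_forall fun x => ?_)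
  have h1 : Real.exp (c * x) = Real.exp ((c - a) * x) * Real.exp (a * x) := by
    rw [← Real.exp_add]; ring_nf
  have h2 : Real.exp (2 * (c - a) * x) = Real.exp ((c - a) * x) ^ 2 := by
    rw [← Real.exp_nat_mul]; push_cast; ring_nf
  have h3 : Real.exp (2 * a * x) = Real.exp (a * x) ^ 2 := by
    rw [← Real.exp_nat_mul]; push_cast; ring_nf
  rw [Real.norm_of_nonneg (by positivity), Pi.add_apply, h1, h2, h3]
  nlinarith [sq_nonneg (Real.exp ((c - a) * x) - Real.exp (a * x) * ‖q x‖),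
    sq_nonneg (Real.exp ((c - a) * x)), sq_nonneg (Real.exp (a * x) * ‖q x‖)]

/-- Joint integrability of the correlation kernel on the quadrant. -/
lemma integrable_exp_mul_correlation {c : ℝ} (hc : 0 ≤ c) {q : ℝ → ℂ} (hq : Measurable q)
    (h₀ : IntegrableOn (fun x => ‖q x‖) (Ioi 0))
    (h₁ : IntegrableOn (fun x => Real.exp (c * x) * ‖q x‖) (Ioi 0)) {w : ℂ} (hw : ‖w‖ ≤ c) :
    Integrable (fun p : ℝ × ℝ => exp (w * p.2) * (q (p.1 + p.2) * (starRingEnd ℂ) (q p.1)))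
      ((volume.restrict (Ioi 0)).prod (volume.restrict (Ioi 0))) := by
  have h₂ := ((integrable_indicator_iff measurableSet_Ioi).2 h₀).mul_prod
    ((integrable_indicator_iff measurableSet_Ioi).2 h₁)
  have h₃ := ((measurePreserving_prod_add (volume : Measure ℝ) volume).integrable_comp
    h₂.aestronglyMeasurable).2 h₂
  rw [Measure.prod_restrict]
  have hconj : Measurable (starRingEnd ℂ) := continuous_conj.measurable
  refine (h₃.restrict (s := Ioi 0 ×ˢ Ioi 0)).mono' (by fun_prop) ?_
  refine (ae_restrict_iff' (measurableSet_Ioi.prod measurableSet_Ioi)).2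
    (Filter.Eventually.of_forall fun p hp => ?_)
  obtain ⟨hx, hs⟩ : 0 < p.1 ∧ 0 < p.2 := hp
  have hxs : p.1 + p.2 ∈ Ioi (0 : ℝ) := add_pos hx hs
  have hx' : p.1 ∈ Ioi (0 : ℝ) := hx
  simp only [Function.comp_apply, indicator_of_mem hx', indicator_of_mem hxs, norm_mul, norm_conj]
  have he : ‖exp (w * p.2)‖ ≤ Real.exp (c * (p.1 + p.2)) :=
    (norm_exp_mul_le hw hs.le).trans (Real.exp_le_exp.2 (by nlinarith))
  calc ‖exp (w * p.2)‖ * (‖q (p.1 + p.2)‖ * ‖q p.1‖)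
      ≤ Real.exp (c * (p.1 + p.2)) * (‖q (p.1 + p.2)‖ * ‖q p.1‖) := by gcongr
    _ = _ := by ring

lemma integral_Ioi_shift (f : ℝ → ℂ) (x : ℝ) :
    ∫ t in Ioi x, f t = ∫ s in Ioi (0:ℝ), f (x + s) := by
  have h := (measurePreserving_add_left volume x).setIntegral_preimage_emb
    (measurableEmbedding_addLeft x) f (Ioi x)
  rw [← h]
  simp

/-- The tail integral in the Jost solution, paired with `q`, yields `ms2`. -/
lemma integral_tail_mul_conj {c : ℝ} {q : ℝ → ℂ} (hq : Measurable q) {lam : ℂ} (hlam : ‖lam‖ ≤ c)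
    (h₀ : IntegrableOn (fun x => ‖q x‖) (Ioi 0))
    (h₁ : IntegrableOn (fun x => Real.exp (c * x) * ‖q x‖) (Ioi 0)) :
    IntegrableOn (fun x : ℝ => (∫ t in Ioi x,
      sfun 2 (I * lam * ((x : ℂ) - (t : ℂ))) / (I * lam) ^ 2 * q t) * (starRingEnd ℂ) (q x))
      (Ioi 0) ∧
    ∫ x in Ioi (0:ℝ), (∫ t in Ioi x,
      sfun 2 (I * lam * ((x : ℂ) - (t : ℂ))) / (I * lam) ^ 2 * q t) * (starRingEnd ℂ) (q x)
      = ms2 q lam := by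
  have hE : ∀ ζ : ℂ, ‖ζ‖ = 1 → Integrable (fun p : ℝ × ℝ =>
      exp (-I * lam * ζ * p.2) * (q (p.1 + p.2) * (starRingEnd ℂ) (q p.1)))
      ((volume.restrict (Ioi 0)).prod (volume.restrict (Ioi 0))) := fun ζ hζ =>
    integrable_exp_mul_correlation ((norm_nonneg _).trans hlam) hq h₀ h₁ (by simpa [hζ] using hlam)
  have hm : ∀ ζ : ℂ, ‖ζ‖ = 1 → Integrable (fun s : ℝ => exp (-I * lam * ζ * s) * gq q s)
      (volume.restrict (Ioi 0)) := fun ζ hζ => by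
    simpa only [integral_const_mul, gq] using (hE ζ hζ).integral_prod_right
  let G : ℝ × ℝ → ℂ := fun p =>
    (ζ₁ * (exp (-I * lam * ζ₁ * p.2) * (q (p.1 + p.2) * (starRingEnd ℂ) (q p.1))) +
      ζ₂ * (exp (-I * lam * ζ₂ * p.2) * (q (p.1 + p.2) * (starRingEnd ℂ) (q p.1))) +
      ζ₃ * (exp (-I * lam * ζ₃ * p.2) * (q (p.1 + p.2) * (starRingEnd ℂ) (q p.1)))) /
      (3 * (I * lam) ^ 2)
  have hG : Integrable G ((volume.restrict (Ioi 0)).prod (volume.restrict (Ioi 0))) :=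
    ((((hE ζ₁ norm_ζ₁).const_mul _).add ((hE ζ₂ norm_ζ₂).const_mul _)).add
      ((hE ζ₃ norm_ζ₃).const_mul _)).div_const _
  have hinner : ∀ x : ℝ, (∫ t in Ioi x, sfun 2 (I * lam * ((x : ℂ) - (t : ℂ))) / (I * lam) ^ 2
      * q t) * (starRingEnd ℂ) (q x) = ∫ s in Ioi (0:ℝ), G (x, s) := fun x => by
    rw [integral_Ioi_shift, ← integral_mul_const]
    congr 1 with s
    have : ∀ ζ : ℂ, I * lam * ((x : ℂ) - ((x + s : ℝ) : ℂ)) * ζ = -I * lam * ζ * s := fun ζ => by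
      push_cast; ring
    simp only [sfun_two, this, G]
    ring
  simp only [hinner]
  refine ⟨hG.integral_prod_left, ?_⟩
  rw [integral_integral_swap hG]
  have hG' : ∀ s : ℝ, ∫ x in Ioi (0:ℝ), G (x, s) =
      (ζ₁ * (exp (-I * lam * ζ₁ * s) * gq q s) + ζ₂ * (exp (-I * lam * ζ₂ * s) * gq q s) +
        ζ₃ * (exp (-I * lam * ζ₃ * s) * gq q s)) / (3 * (I * lam) ^ 2) := fun s => by
    trans ∫ x in Ioi (0:ℝ), (ζ₁ * exp (-I * lam * ζ₁ * s) + ζ₂ * exp (-I * lam * ζ₂ * s) +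
      ζ₃ * exp (-I * lam * ζ₃ * s)) / (3 * (I * lam) ^ 2) * (q (x + s) * (starRingEnd ℂ) (q x))
    · congr 1 with x
      simp only [G]
      ring
    · rw [integral_const_mul, ← gq]
      ring
  simp only [hG']
  have hi₁ := (hm ζ₁ norm_ζ₁).const_mul ζ₁
  have hi₂ := (hm ζ₂ norm_ζ₂).const_mul ζ₂
  have hi₁₂ : Integrable (fun s : ℝ => ζ₁ * (exp (-I * lam * ζ₁ * s) * gq q s) +
      ζ₂ * (exp (-I * lam * ζ₂ * s) * gq q s)) (volume.restrict (Ioi 0)) := hi₁.add hi₂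
  rw [integral_div, integral_add hi₁₂ ((hm ζ₃ norm_ζ₃).const_mul _), integral_add hi₁ hi₂]
  simp only [integral_const_mul, ms2, mker]

lemma integral_jost_mul_conj {a : ℝ} (ha : 0 < a) (α : ℝ) {q : ℝ → ℂ} (hq : Measurable q)
    (hint : IntegrableOn (fun x => Real.exp (2 * a * x) * ‖q x‖ ^ 2) (Ioi 0))
    {lam : ℂ} (hlam : ‖lam‖ < a) {ζk ζc : ℂ} (hk : ‖ζk‖ = 1) (hc : (starRingEnd ℂ) ζc = ζk) :
    ∫ x in Ioi (0:ℝ), jost α q ζk ζc lam x * (starRingEnd ℂ) (q x) = starF (qt q ζc) lam := by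
  have h₀ : IntegrableOn (fun x => ‖q x‖) (Ioi 0) := by
    simpa using integrableOn_exp_mul_norm ha hq hint
  have h₁ := integrableOn_exp_mul_norm hlam hq hint
  have hconj : Measurable (starRingEnd ℂ) := continuous_conj.measurable
  have hA : IntegrableOn (fun x : ℝ => exp (I * lam * ζk * x) * (starRingEnd ℂ) (q x)) (Ioi 0) := by
    refine h₁.mono' (by fun_prop) ?_
    refine (ae_restrict_iff' measurableSet_Ioi).2 (Filter.Eventually.of_forall fun x hx => ?_)
    rw [norm_mul, norm_conj]
    gcongr
    exact norm_exp_mul_le (by simp [hk]) (le_of_lt hx)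
  obtain ⟨hT, hTeq⟩ := integral_tail_mul_conj hq le_rfl h₀ h₁
  have hstar := starF_qt q ζc lam
  rw [hc] at hstar
  simp only [jost, sub_mul, mul_assoc (bcoef α q lam), mul_assoc (I * α * starF (qt q ζc) lam)]
  rw [integral_sub (hA.const_mul _) (hT.const_mul _), integral_const_mul, integral_const_mul, hTeq,
    ← hstar, bcoef]
  ring

theorem stmt15 (a : ℝ) (ha : 0 < a) (α : ℝ) (q : ℝ → ℂ) (hq : Measurable q)
    (hint : IntegrableOn (fun x => Real.exp (2 * a * x) * ‖q x‖ ^ 2) (Ioi 0))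
    (lam : ℂ) (h0 : lam ≠ 0) (hlam : ‖lam‖ < a / 3) :
    (∫ x in Ioi (0:ℝ), psi1 α q lam x * (starRingEnd ℂ) (q x)) = starF (qt q ζ₁) lam ∧
    (∫ x in Ioi (0:ℝ), psi2 α q lam x * (starRingEnd ℂ) (q x)) = starF (qt q ζ₃) lam ∧
    (∫ x in Ioi (0:ℝ), psi3 α q lam x * (starRingEnd ℂ) (q x)) = starF (qt q ζ₂) lam := by
  have hlam' : ‖lam‖ < a := by linarith
  exact ⟨integral_jost_mul_conj ha α hq hint hlam' norm_ζ₁ conj_ζ₁,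
    integral_jost_mul_conj ha α hq hint hlam' norm_ζ₂ conj_ζ₃,
    integral_jost_mul_conj ha α hq hint hlam' norm_ζ₃ conj_ζ₂⟩
end
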